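/- (Explicit conditional posterior of Lemma 1.) Under the posterior in which ξ = Tβ has density t(ξ; Tβ̂, s²(n−k)⁻¹ T(XᵀX)⁻¹Tᵀ, n−k), the conditional density of ξ_I given ξ_E = r_E, i.e. the ratio t((r_E, ξ_I); Tβ̂, s²(n−k)⁻¹T(XᵀX)⁻¹Tᵀ, n−k) / t(r_E; R_Eβ̂, s²(n−k)⁻¹R_E(XᵀX)⁻¹R_Eᵀ, n−k), equals t(ξ_I; μ_I^N, S_I^N, n−k+q_E) for every ξ_I ∈ ℝ^{k−q_E}, where μ_I^N = Dβ̂ + D(XᵀX)⁻¹R_Eᵀ(R_E(XᵀX)⁻¹R_Eᵀ)⁻¹(r_E − R_Eβ̂) and S_I^N = (1 + s⁻²(r_E − R_Eβ̂)ᵀ(R_E(XᵀX)⁻¹R_Eᵀ)⁻¹(r_E − R_Eβ̂)) · (n−k+q_E)⁻¹ s² · (D(XᵀX)⁻¹Dᵀ − D(XᵀX)⁻¹R_Eᵀ(R_E(XᵀX)⁻¹R_Eᵀ)⁻¹R_E(XᵀX)⁻¹Dᵀ). -/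

import Mathlib

open Matrix MeasureTheory

/-- The multivariate Student `t` density. -/
noncomputable def studentT {d : ℕ} (ν : ℝ) (m : Fin d → ℝ)
    (S : Matrix (Fin d) (Fin d) ℝ) (x : Fin d → ℝ) : ℝ :=
  Real.Gamma ((ν + d) / 2) /
      (Real.Gamma (ν / 2) * (ν * Real.pi) ^ ((d : ℝ) / 2) * Real.sqrt S.det) *
    (1 + (x - m) ⬝ᵥ S⁻¹.mulVec (x - m) / ν) ^ (-(ν + d) / 2)

/-- The vector `(ξ_E, ξ_I) ∈ ℝ^{q_E} × ℝ^{k−q_E}` stacked into `ℝ^k`. -/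
def stackVec {k qE : ℕ} (hq : qE ≤ k) (ξE : Fin qE → ℝ) (ξI : Fin (k - qE) → ℝ) :
    Fin k → ℝ := fun i =>
  Sum.elim ξE ξI ((finSumFinEquiv.trans (finCongr (Nat.add_sub_cancel' hq))).symm i)

/-- The `k × k` matrix `T` obtained by stacking `R_E` on top of `D`. -/
def stackMat {k qE : ℕ} (hq : qE ≤ k) (RE : Matrix (Fin qE) (Fin k) ℝ)
    (D : Matrix (Fin (k - qE)) (Fin k) ℝ) : Matrix (Fin k) (Fin k) ℝ :=
  (Matrix.fromRows RE D).submatrix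
    (finSumFinEquiv.trans (finCongr (Nat.add_sub_cancel' hq))).symm id

/-- The OLS estimate `β̂ = (XᵀX)⁻¹Xᵀy`. -/
noncomputable def betaHat {n k : ℕ} (y : Fin n → ℝ) (X : Matrix (Fin n) (Fin k) ℝ) :
    Fin k → ℝ := (Xᵀ * X)⁻¹.mulVec (Xᵀ.mulVec y)

/-- The sum of squares `s² = ‖y − Xβ̂‖²`. -/
noncomputable def sSq {n k : ℕ} (y : Fin n → ℝ) (X : Matrix (Fin n) (Fin k) ℝ) : ℝ :=
  (y - X.mulVec (betaHat y X)) ⬝ᵥ (y - X.mulVec (betaHat y X))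

/-- A matrix of full row rank acts injectively on row vectors. -/
theorem vecMul_injective_of_rank_eq {m n : ℕ} {M : Matrix (Fin m) (Fin n) ℝ} (hM : M.rank = m) :
    Function.Injective M.vecMul := by
  rw [Matrix.vecMul_injective_iff, linearIndependent_iff_card_eq_finrank_span, Set.finrank,
    ← M.rank_eq_finrank_span_row, hM, Fintype.card_fin]

/-- A full-row-rank matrix `D` whose rows are orthogonal to those of `R` has a positive definite
Schur complement in the Gram matrix of the stacked rows with respect to a positive definite `G`. -/
theorem posDef_schurComplement_gram {p q k : ℕ} {G : Matrix (Fin k) (Fin k) ℝ} (hG : G.PosDef)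
    {R : Matrix (Fin q) (Fin k) ℝ} {D : Matrix (Fin p) (Fin k) ℝ}
    (hA : (R * G * Rᵀ).PosDef) (hD : Function.Injective D.vecMul) (hDR : D * Rᵀ = 0) :
    (D * G * Dᵀ - D * G * Rᵀ * (R * G * Rᵀ)⁻¹ * (R * G * Dᵀ)).PosDef := by
  set A := R * G * Rᵀ with hAdef
  have hAu : IsUnit A.det := (Matrix.isUnit_iff_isUnit_det A).mp hA.isUnit
  have hGt : Gᵀ = G := by simpa using hG.isHermitian.eq
  have hAt : Aᵀ = A := by simpa using hA.isHermitian.eq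
  set M := D - D * G * Rᵀ * A⁻¹ * R with hM
  have hMt : Mᵀ = Dᵀ - Rᵀ * A⁻¹ * R * G * Dᵀ := by
    simp [hM, Matrix.transpose_mul, hGt, Matrix.transpose_nonsing_inv, hAt, Matrix.mul_assoc]
  have hRM : R * G * Mᵀ = 0 := by
    have h : R * G * (Rᵀ * A⁻¹ * R * G * Dᵀ) = A * A⁻¹ * (R * G * Dᵀ) := by
      simp only [hAdef, Matrix.mul_assoc]
    rw [hMt, Matrix.mul_sub, h, Matrix.mul_nonsing_inv _ hAu, Matrix.one_mul, sub_self]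
  have hSchur : D * G * Dᵀ - D * G * Rᵀ * A⁻¹ * (R * G * Dᵀ) = M * G * Mᵀ := by
    have h : M * G * Mᵀ = D * G * Mᵀ - D * G * Rᵀ * A⁻¹ * (R * G * Mᵀ) := by
      simp only [hM, Matrix.sub_mul, Matrix.mul_assoc]
    rw [h, hRM, Matrix.mul_zero, sub_zero, hMt, Matrix.mul_sub]
    simp only [Matrix.mul_assoc]
  have hMD : M * Dᵀ = D * Dᵀ := by
    have h : R * Dᵀ = 0 := by simpa using congrArg Matrix.transpose hDR
    rw [hM, Matrix.sub_mul, Matrix.mul_assoc _ R, h, Matrix.mul_zero, sub_zero]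
  have hDD : (D * Dᵀ).PosDef := by simpa using Matrix.PosDef.mul_conjTranspose_self D hD
  have hMinj : Function.Injective M.vecMul := by
    intro v w hvw
    refine Matrix.vecMul_injective_of_isUnit hDD.isUnit ?_
    change v ᵥ* (D * Dᵀ) = w ᵥ* (D * Dᵀ)
    rw [← hMD, ← Matrix.vecMul_vecMul, ← Matrix.vecMul_vecMul]
    exact congrArg (· ᵥ* Dᵀ) hvw
  rw [hSchur]
  simpa using hG.mul_mul_conjTranspose_same hMinj

/-- The quadratic form of the inverse of a symmetric block matrix splits along the Schur
complement of its top left block. -/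
theorem dotProduct_inv_fromBlocks_mulVec {m n : Type*} [Fintype m] [Fintype n] [DecidableEq m]
    [DecidableEq n] (A : Matrix m m ℝ) (B : Matrix m n ℝ) (E : Matrix n n ℝ) (hAt : Aᵀ = A)
    (hA : IsUnit A.det) (hS : IsUnit (E - Bᵀ * A⁻¹ * B).det) (u : m → ℝ) (v : n → ℝ) :
    Sum.elim u v ⬝ᵥ (fromBlocks A B Bᵀ E)⁻¹ *ᵥ Sum.elim u v =
      u ⬝ᵥ A⁻¹ *ᵥ u + (v - (Bᵀ * A⁻¹) *ᵥ u) ⬝ᵥ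
        (E - Bᵀ * A⁻¹ * B)⁻¹ *ᵥ (v - (Bᵀ * A⁻¹) *ᵥ u) := by
  set S := E - Bᵀ * A⁻¹ * B with hSdef
  set w := v - (Bᵀ * A⁻¹) *ᵥ u with hw
  have hdet : IsUnit (fromBlocks A B Bᵀ E).det := by
    let := Matrix.invertibleOfIsUnitDet A hA
    rw [Matrix.det_fromBlocks₁₁, Matrix.invOf_eq_nonsing_inv]
    exact hA.mul hS
  have hsol : fromBlocks A B Bᵀ E *ᵥ Sum.elim (A⁻¹ *ᵥ (u - B *ᵥ S⁻¹ *ᵥ w)) (S⁻¹ *ᵥ w) =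
      Sum.elim u v := by
    rw [Matrix.fromBlocks_mulVec]
    congr 1
    · simp [Matrix.mulVec_mulVec, Matrix.mul_nonsing_inv _ hA]
    · have h : E *ᵥ (S⁻¹ *ᵥ w) = w + (Bᵀ * A⁻¹ * B) *ᵥ (S⁻¹ *ᵥ w) := by
        rw [show E = S + Bᵀ * A⁻¹ * B by rw [hSdef, sub_add_cancel], Matrix.add_mulVec,
          Matrix.mulVec_mulVec w S, Matrix.mul_nonsing_inv _ hS, Matrix.one_mulVec]
      simp only [Sum.elim_comp_inl, Sum.elim_comp_inr]
      rw [h, hw]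
      simp only [Matrix.mulVec_sub, Matrix.mulVec_mulVec, Matrix.mul_assoc]
      abel
  have hinv : (fromBlocks A B Bᵀ E)⁻¹ *ᵥ Sum.elim u v =
      Sum.elim (A⁻¹ *ᵥ (u - B *ᵥ S⁻¹ *ᵥ w)) (S⁻¹ *ᵥ w) := by
    rw [← hsol, Matrix.mulVec_mulVec, Matrix.nonsing_inv_mul _ hdet, Matrix.one_mulVec]
  have hcross : u ⬝ᵥ A⁻¹ *ᵥ (B *ᵥ S⁻¹ *ᵥ w) = ((Bᵀ * A⁻¹) *ᵥ u) ⬝ᵥ S⁻¹ *ᵥ w := by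
    rw [Matrix.mulVec_mulVec, Matrix.dotProduct_mulVec, ← Matrix.mulVec_transpose,
      Matrix.transpose_mul, Matrix.transpose_nonsing_inv, hAt]
  rw [hinv, sumElim_dotProduct_sumElim, Matrix.mulVec_sub, dotProduct_sub, hcross]
  nth_rewrite 4 [hw]
  rw [sub_dotProduct]
  ring

/-- The Student density with scale matrix `c • S`, with the scalar moved out of the matrix. -/
theorem studentT_smul {d : ℕ} {ν c : ℝ} (hν : 0 < ν) (hc : 0 < c) (m : Fin d → ℝ)
    (S : Matrix (Fin d) (Fin d) ℝ) (x : Fin d → ℝ) :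
    studentT ν m (c • S) x =
      Real.Gamma ((ν + d) / 2) /
          (Real.Gamma (ν / 2) * (ν * c * Real.pi) ^ ((d : ℝ) / 2) * Real.sqrt S.det) *
        (1 + (x - m) ⬝ᵥ S⁻¹ *ᵥ (x - m) / (ν * c)) ^ (-(ν + d) / 2) := by
  have hpow : (ν * c * Real.pi) ^ ((d : ℝ) / 2) =
      (ν * Real.pi) ^ ((d : ℝ) / 2) * Real.sqrt (c ^ d) := by
    rw [show ν * c * Real.pi = (ν * Real.pi) * c by ring,
      Real.mul_rpow (by positivity) hc.le, Real.sqrt_eq_rpow, ← Real.rpow_natCast,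
      ← Real.rpow_mul hc.le]
    congr 2
    ring
  have hinv : (c • S)⁻¹ = c⁻¹ • S⁻¹ := by
    by_cases h : IsUnit S.det
    · exact Matrix.inv_smul' S (Units.mk0 c hc.ne') h
    · rcases Nat.eq_zero_or_pos d with rfl | hd
      · exact Subsingleton.elim _ _
      · rw [Matrix.nonsing_inv_apply_not_isUnit _ h, Matrix.nonsing_inv_apply_not_isUnit, smul_zero]
        simpa [Matrix.det_smul, hc.ne'] using h
  rw [studentT, hinv, Matrix.det_smul, Fintype.card_fin, Real.sqrt_mul (by positivity), hpow,
    Matrix.smul_mulVec, dotProduct_smul, smul_eq_mul]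
  congr 2
  · ring
  · rw [← div_eq_inv_mul, div_div, mul_comm c]

theorem stackVec_eq_comp {k q : ℕ} (hq : q ≤ k) (u : Fin q → ℝ) (v : Fin (k - q) → ℝ) :
    stackVec hq u v =
      Sum.elim u v ∘ (finSumFinEquiv.trans (finCongr (Nat.add_sub_cancel' hq))).symm := rfl

theorem stackMat_mulVec {k q : ℕ} (hq : q ≤ k) (R : Matrix (Fin q) (Fin k) ℝ)
    (D : Matrix (Fin (k - q)) (Fin k) ℝ) (b : Fin k → ℝ) :
    stackMat hq R D *ᵥ b = stackVec hq (R *ᵥ b) (D *ᵥ b) := by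
  rw [stackVec_eq_comp, ← Matrix.fromRows_mulVec]
  rfl

theorem stackVec_sub {k q : ℕ} (hq : q ≤ k) (u u' : Fin q → ℝ) (v v' : Fin (k - q) → ℝ) :
    stackVec hq u v - stackVec hq u' v' = stackVec hq (u - u') (v - v') := by
  funext i
  simp only [stackVec_eq_comp, Pi.sub_apply, Function.comp_apply]
  cases (finSumFinEquiv.trans (finCongr (Nat.add_sub_cancel' hq))).symm i <;> rfl

theorem stackMat_mul_mul_transpose {k q : ℕ} (hq : q ≤ k) (R : Matrix (Fin q) (Fin k) ℝ)
    (D : Matrix (Fin (k - q)) (Fin k) ℝ) (G : Matrix (Fin k) (Fin k) ℝ) :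
    stackMat hq R D * G * (stackMat hq R D)ᵀ =
      (fromBlocks (R * G * Rᵀ) (R * G * Dᵀ) (D * G * Rᵀ) (D * G * Dᵀ)).submatrix
        (finSumFinEquiv.trans (finCongr (Nat.add_sub_cancel' hq))).symm
        (finSumFinEquiv.trans (finCongr (Nat.add_sub_cancel' hq))).symm := by
  rw [← Matrix.fromRows_mul_fromCols, ← Matrix.fromRows_mul, ← Matrix.transpose_fromRows]
  rfl

/-- **explicit conditional posterior of Lemma 1.** Under the posterior in
which `ξ = Tβ` has density `t(ξ; Tβ̂, s²(n−k)⁻¹T(XᵀX)⁻¹Tᵀ, n−k)`, the conditional density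
of `ξ_I` given `ξ_E = r_E` equals `t(ξ_I; μ_I^N, S_I^N, n−k+q_E)`. -/
theorem stmt_15 {n k qE : ℕ} (hnk : k < n) (hq : qE < k)
    (y : Fin n → ℝ) (X : Matrix (Fin n) (Fin k) ℝ) (hX : IsUnit (Xᵀ * X))
    (hs2 : 0 < sSq y X)
    (RE : Matrix (Fin qE) (Fin k) ℝ) (rE : Fin qE → ℝ)
    (D : Matrix (Fin (k - qE)) (Fin k) ℝ)
    (hRE : RE.rank = qE) (hD : D.rank = k - qE) (hDRE : D * REᵀ = 0) :
    let βhat := betaHat y X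
    let s2 := sSq y X
    let T := stackMat hq.le RE D
    let G := (Xᵀ * X)⁻¹
    let μN := D.mulVec βhat +
      (D * G * REᵀ * (RE * G * REᵀ)⁻¹).mulVec (rE - RE.mulVec βhat)
    let SN := ((1 + s2⁻¹ * ((rE - RE.mulVec βhat) ⬝ᵥ
          (RE * G * REᵀ)⁻¹.mulVec (rE - RE.mulVec βhat))) *
        (s2 / ((n : ℝ) - k + qE))) •
      (D * G * Dᵀ - D * G * REᵀ * (RE * G * REᵀ)⁻¹ * (RE * G * Dᵀ))
    ∀ ξI : Fin (k - qE) → ℝ,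
      studentT ((n : ℝ) - k) (T.mulVec βhat)
          ((s2 / ((n : ℝ) - k)) • (T * G * Tᵀ)) (stackVec hq.le rE ξI) /
        studentT ((n : ℝ) - k) (RE.mulVec βhat)
          ((s2 / ((n : ℝ) - k)) • (RE * G * REᵀ)) rE =
      studentT ((n : ℝ) - k + qE) μN SN ξI := by
  intro βhat s2 T G μN SN ξI
  have hk : (k : ℝ) < n := by exact_mod_cast hnk
  have hν : 0 < (n : ℝ) - k := sub_pos.mpr hk
  have hν' : 0 < (n : ℝ) - k + qE := by positivity
  have hs : 0 < s2 := hs2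
  have hXX : (Xᵀ * X).PosDef := by
    have h : (Xᵀ * X).PosSemidef := by simpa using Matrix.posSemidef_conjTranspose_mul_self X
    exact h.posDef_iff_isUnit.mpr hX
  have hG : G.PosDef := hXX.inv
  have hGt : Gᵀ = G := by simpa using hG.isHermitian.eq
  have hA : (RE * G * REᵀ).PosDef := by
    simpa using hG.mul_mul_conjTranspose_same (vecMul_injective_of_rank_eq hRE)
  have hS := posDef_schurComplement_gram hG hA (vecMul_injective_of_rank_eq hD) hDRE
  have hBt : (RE * G * Dᵀ)ᵀ = D * G * REᵀ := by
    simp [Matrix.transpose_mul, hGt, Matrix.mul_assoc]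
  set A := RE * G * REᵀ with hAdef
  set S := D * G * Dᵀ - D * G * REᵀ * A⁻¹ * (RE * G * Dᵀ) with hSdef
  set u := rE - RE *ᵥ βhat
  have hAt : Aᵀ = A := by simpa using hA.isHermitian.eq
  have hAu : IsUnit A.det := hA.det_pos.ne'.isUnit
  have hSu : IsUnit S.det := hS.det_pos.ne'.isUnit
  set a := u ⬝ᵥ A⁻¹ *ᵥ u with ha
  set b := (ξI - μN) ⬝ᵥ S⁻¹ *ᵥ (ξI - μN) with hb
  have ha0 : 0 ≤ a := hA.inv.posSemidef.dotProduct_mulVec_nonneg u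
  have hb0 : 0 ≤ b := hS.inv.posSemidef.dotProduct_mulVec_nonneg (ξI - μN)
  have hquad : (stackVec hq.le rE ξI - T *ᵥ βhat) ⬝ᵥ
      (T * G * Tᵀ)⁻¹ *ᵥ (stackVec hq.le rE ξI - T *ᵥ βhat) = a + b := by
    have hμ : ξI - μN = (ξI - D *ᵥ βhat) - (D * G * REᵀ * A⁻¹) *ᵥ u := by
      rw [sub_sub]
    rw [stackMat_mulVec, stackVec_sub, stackMat_mul_mul_transpose, Matrix.inv_submatrix_equiv,
      stackVec_eq_comp, Matrix.submatrix_mulVec_equiv, comp_equiv_dotProduct_comp_equiv,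
      Function.comp_assoc, Equiv.self_comp_symm, Function.comp_id, ← hBt,
      dotProduct_inv_fromBlocks_mulVec _ _ _ hAt hAu (by rw [hBt]; exact hSu), hBt, ← hSdef,
      hb, hμ]
  have hdet : (T * G * Tᵀ).det = A.det * S.det := by
    let := Matrix.invertibleOfIsUnitDet A hAu
    rw [stackMat_mul_mul_transpose, Matrix.det_submatrix_equiv_self, ← hAdef,
      Matrix.det_fromBlocks₁₁, Matrix.invOf_eq_nonsing_inv]
  have hcN : 0 < (1 + s2⁻¹ * a) * (s2 / ((n : ℝ) - k + qE)) := by positivity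
  have hSN : SN = ((1 + s2⁻¹ * a) * (s2 / ((n : ℝ) - k + qE))) • S := rfl
  have hkcast : ((k - qE : ℕ) : ℝ) = (k : ℝ) - qE := Nat.cast_sub hq.le
  rw [studentT_smul hν (by positivity), studentT_smul hν (by positivity),
    hSN, studentT_smul hν' hcN, hquad, hdet, ← ha, ← hb, hkcast,
    mul_div_cancel₀ s2 hν.ne', Real.sqrt_mul hA.det_pos.le]
  set q := (qE : ℝ)
  set ν := (n : ℝ) - k
  have hscale : (ν + q) * ((1 + s2⁻¹ * a) * (s2 / (ν + q))) = s2 * (1 + a / s2) := by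
    field_simp
  set c := 1 + a / s2 with hc
  set d := 1 + b / (s2 * c) with hd
  have hc0 : 0 < c := by positivity
  have hd0 : 0 < d := by positivity
  have hcd : 1 + (a + b) / s2 = c * d := by
    rw [hd, hc]
    have : s2 + a ≠ 0 := by positivity
    field_simp
    ring
  have hP : 0 < s2 * Real.pi := by positivity
  have hPk : (s2 * Real.pi) ^ ((k : ℝ) / 2) =
      (s2 * Real.pi) ^ (q / 2) * (s2 * Real.pi) ^ (((k : ℝ) - q) / 2) := by
    rw [← Real.rpow_add hP]
    congr 1
    ring
  have hck : c ^ (-(ν + k) / 2) = c ^ (-(ν + q) / 2) * (c ^ (((k : ℝ) - q) / 2))⁻¹ := by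
    rw [← Real.rpow_neg hc0.le, ← Real.rpow_add hc0]
    congr 1
    ring
  have hΓν : Real.Gamma (ν / 2) ≠ 0 := (Real.Gamma_pos_of_pos (by positivity)).ne'
  have hΓq : Real.Gamma ((ν + q) / 2) ≠ 0 := (Real.Gamma_pos_of_pos (by positivity)).ne'
  have hsA : √A.det ≠ 0 := (Real.sqrt_pos.mpr hA.det_pos).ne'
  have hsS : √S.det ≠ 0 := (Real.sqrt_pos.mpr hS.det_pos).ne'
  have hPq0 := (Real.rpow_pos_of_pos hP (q / 2)).ne'
  have hPp0 := (Real.rpow_pos_of_pos hP (((k : ℝ) - q) / 2)).ne'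
  have hcq0 := (Real.rpow_pos_of_pos hc0 (-(ν + q) / 2)).ne'
  have hcp0 := (Real.rpow_pos_of_pos hc0 (((k : ℝ) - q) / 2)).ne'
  rw [hscale, hcd, show ν + q + (k - q) = ν + k by ring, hPk, Real.mul_rpow hc0.le hd0.le, hck,
    mul_right_comm s2 c, Real.mul_rpow hP.le hc0.le]
  generalize (s2 * Real.pi) ^ (q / 2) = P₁ at *
  generalize (s2 * Real.pi) ^ (((k : ℝ) - q) / 2) = P₂ at *
  generalize c ^ (-(ν + q) / 2) = C₁ at *
  generalize c ^ (((k : ℝ) - q) / 2) = C₂ at *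
  generalize d ^ (-(ν + k) / 2) = D₁ at *
  field_simp
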